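/- arXiv:2503.20155 — 2 statements merged into one kernel-verified Lean document; each statement's English description precedes it below -/
import Mathlib

section
/- Let m > n be positive integers, let α = (α_1,…,α_ℓ) be a composition of n with ℓ parts, set r = rr(α,m), and let k and j be positive integers with k ≥ r, j ≥ r and k + j − r ≤ ℓ. Then |D_{m,α}^{(k,j)}| = |D_{m,α}^{(k+j−r, r)}| = |T(m,α,k+j−r)|. -/
open scoped Classical

namespace RationalDyck

/-- A lattice path: `true` = a north step `N`, `false` = an east step `E`. -/
abbrev Path : Type := List Bool

/-- The rank of the endpoint of a path prefix `Q` in the `m × n` grid: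
`rank(i,j) = j*m - i*n`, where `i` is the number of east steps of `Q`
and `j` the number of north steps of `Q`. -/
def prefRank (m n : ℕ) (Q : Path) : ℤ :=
  (Q.count true : ℤ) * m - (Q.count false : ℤ) * n

/-- `P` is an `m × n` rational Dyck path: it goes from `(0,0)` to `(m,n)` and
stays weakly above the line `y = n x / m`. -/
def IsDyck (m n : ℕ) (P : Path) : Prop :=
  P.count false = m ∧ P.count true = n ∧ ∀ i ≤ P.length, 0 ≤ prefRank m n (P.take i)

/-- The return statistic: the number of lattice points on `P` other than `(m,n)`
whose rank is strictly less than `n`. -/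
def retStat (m n : ℕ) (P : Path) : ℕ :=
  ((List.range P.length).filter fun i => prefRank m n (P.take i) < (n : ℤ)).length

/-- The coarea sequence of `P`: for each north step (from bottom to top), the number
of cells of the rectangle strictly to its left, i.e. the number of east steps before it. -/
def coarea (P : Path) : List ℕ :=
  (List.range P.length).filterMap fun i =>
    if P.getD i false = true then some ((P.take i).count false) else none

/-- The run statistic: the least `i ∈ [n]` not appearing in the coarea sequence. -/
noncomputable def runStat (P : Path) : ℕ :=
  sInf {i : ℕ | 1 ≤ i ∧ i ≤ P.count true ∧ i ∉ coarea P}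

/-- The ratio-run statistic: with `k = ⌊m/n⌋`, the least `i ∈ [n]` such that `k*i`
does not appear in the coarea sequence. -/
noncomputable def ratioRun (m n : ℕ) (P : Path) : ℕ :=
  sInf {i : ℕ | 1 ≤ i ∧ i ≤ P.count true ∧ (m / n) * i ∉ coarea P}

/-- The composition type of `P`: the lengths of the maximal blocks of consecutive
north steps, read from start to end. -/
def compType (P : Path) : List ℕ :=
  ((P.splitOn false).map List.length).filter fun x => x ≠ 0

/-- The number of maximal blocks of consecutive north steps (vertical components). -/
def nc (P : Path) : ℕ := (compType P).length

/-- `α` is a (strong) composition of `n`. -/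
def IsComposition (n : ℕ) (α : List ℕ) : Prop :=
  (∀ a ∈ α, 0 < a) ∧ α.sum = n

/-- The finite set of all `m × n` rational Dyck paths. -/
noncomputable def dyckPaths (m n : ℕ) : Finset Path :=
  ((Finset.univ : Finset (Fin (m + n) → Bool)).image List.ofFn).filter fun P => IsDyck m n P

/-- The `m × n` rational Dyck paths of composition type `α`. -/
noncomputable def dyckPathsComp (m n : ℕ) (α : List ℕ) : Finset Path :=
  (dyckPaths m n).filter fun P => compType P = α

/-- The `m × n` rational Dyck paths with `run = k` and `ret = l`. -/
noncomputable def dyckPathsRR (m n k l : ℕ) : Finset Path :=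
  (dyckPaths m n).filter fun P => runStat P = k ∧ retStat m n P = l

/-- The `m × n` rational Dyck paths of composition type `α` with `run = k` and `ret = l`. -/
noncomputable def dyckPathsCompRR (m n : ℕ) (α : List ℕ) (k l : ℕ) : Finset Path :=
  (dyckPathsComp m n α).filter fun P => runStat P = k ∧ retStat m n P = l

/-- The number of initial parts of `α` equal to `1`. -/
def iones (α : List ℕ) : ℕ := (α.takeWhile fun a => a = 1).length

/-- `rr(α, m) = min(Iones(α) + 1, ⌈n/(m-n)⌉)` where `n = |α|` is the sum of parts. -/
def rr (m : ℕ) (α : List ℕ) : ℕ :=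
  min (iones α + 1) ((α.sum + (m - α.sum) - 1) / (m - α.sum))


/-- The rank of the lattice point `(x, y)` in the `m × n` grid. -/
def ptRank (m n x y : ℕ) : ℤ := (y : ℤ) * m - (x : ℤ) * n

/-- `T` is a valid suffix path in `T(m, α, j)`: a lattice path from
`(j+1, α_1 + ⋯ + α_j)` to `(m, n)` (where `n = |α|`) staying weakly above the line
`y = n x / m`, with no north step starting at a point of rank `< n`, and whose maximal
blocks of consecutive north steps have lengths `α_{j+1}, …, α_ℓ` in this order. -/
def IsTPath (m : ℕ) (α : List ℕ) (j : ℕ) (T : Path) : Prop :=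
  T.count false + (j + 1) = m ∧
  T.count true + (α.take j).sum = α.sum ∧
  (∀ i ≤ T.length,
    0 ≤ ptRank m α.sum (j + 1 + (T.take i).count false) ((α.take j).sum + (T.take i).count true)) ∧
  (∀ i < T.length, T.getD i false = true →
    (α.sum : ℤ) ≤
      ptRank m α.sum (j + 1 + (T.take i).count false) ((α.take j).sum + (T.take i).count true)) ∧
  compType T = α.drop j

/-- The finite set `T(m, α, j)` of valid suffix paths. -/
noncomputable def tPaths (m : ℕ) (α : List ℕ) (j : ℕ) : Finset Path :=
  ((Finset.univ : Finset (Fin ((m - (j + 1)) + (α.sum - (α.take j).sum)) → Bool)).image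
      List.ofFn).filter fun T => IsTPath m α j T

/-- `P`, started at a point of rank `ρ`, only visits points of nonnegative rank. -/
def Above (m n : ℕ) : ℤ → Path → Prop
  | ρ, [] => 0 ≤ ρ
  | ρ, b :: P => 0 ≤ ρ ∧ Above m n (ρ + if b then (m : ℤ) else -n) P

/-- The number of points of rank `< n` on `P`, started at a point of rank `ρ`,
not counting the endpoint of `P`. -/
def rets (m n : ℕ) : ℤ → Path → ℕ
  | _, [] => 0
  | ρ, b :: P => (if ρ < n then 1 else 0) + rets m n (ρ + if b then (m : ℤ) else -n) P

lemma prefRank_nil (m n : ℕ) : prefRank m n [] = 0 := by simp [prefRank]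

lemma prefRank_cons (m n : ℕ) (b : Bool) (P : Path) :
    prefRank m n (b :: P) = (if b then (m : ℤ) else -n) + prefRank m n P := by
  cases b <;> simp [prefRank] <;> ring

lemma above_iff (m n : ℕ) (ρ : ℤ) (P : Path) :
    Above m n ρ P ↔ ∀ i ≤ P.length, 0 ≤ ρ + prefRank m n (P.take i) := by
  induction P generalizing ρ with
  | nil => simp [Above, prefRank_nil]
  | cons b P ih =>
    rw [Above, ih]
    constructor
    · rintro ⟨h0, h⟩ (_ | i) hi
      · simpa [prefRank_nil] using h0
      · have := h i (by simpa using hi)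
        rw [List.take_succ_cons, prefRank_cons]
        linarith
    · intro h
      refine ⟨by simpa [prefRank_nil] using h 0 (by simp), fun i hi => ?_⟩
      have := h (i + 1) (by simpa using hi)
      rw [List.take_succ_cons, prefRank_cons] at this
      linarith

lemma length_filter_eq_rets (m n : ℕ) (ρ : ℤ) (P : Path) :
    ((List.range P.length).filter fun i => ρ + prefRank m n (P.take i) < (n : ℤ)).length =
      rets m n ρ P := by
  induction P generalizing ρ with
  | nil => simp [rets]
  | cons b P ih =>
    rw [rets, ← ih, List.length_cons, List.range_succ_eq_map, List.filter_cons, List.filter_map]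
    simp only [List.take_zero, prefRank_nil, add_zero, decide_eq_true_eq, Function.comp_def,
      List.take_succ_cons, prefRank_cons, ← add_assoc]
    by_cases h : ρ < n <;> simp [h, add_comm]

lemma retStat_eq_rets (m n : ℕ) (P : Path) : retStat m n P = rets m n 0 P := by
  simp [← length_filter_eq_rets, retStat]

lemma Above.nonneg {m n : ℕ} {ρ : ℤ} {P : Path} (h : Above m n ρ P) : 0 ≤ ρ := by
  cases P with
  | nil => exact h
  | cons b P => exact h.1

lemma above_append (m n : ℕ) (ρ : ℤ) (P Q : Path) :
    Above m n ρ (P ++ Q) ↔ Above m n ρ P ∧ Above m n (ρ + prefRank m n P) Q := by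
  induction P generalizing ρ with
  | nil => simpa [Above, prefRank_nil] using fun h => h.nonneg
  | cons b P ih => simp [Above, ih, prefRank_cons, and_assoc, add_assoc]

lemma rets_append (m n : ℕ) (ρ : ℤ) (P Q : Path) :
    rets m n ρ (P ++ Q) = rets m n ρ P + rets m n (ρ + prefRank m n P) Q := by
  induction P generalizing ρ with
  | nil => simp [rets, prefRank_nil]
  | cons b P ih => simp [rets, ih, prefRank_cons, add_assoc]

lemma above_replicate_true (m n a : ℕ) {ρ : ℤ} (hρ : 0 ≤ ρ) :
    Above m n ρ (List.replicate a true) := by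
  induction a generalizing ρ with
  | zero => exact hρ
  | succ a ih => exact ⟨hρ, ih (by simp; positivity)⟩

lemma above_replicate_false (m n e : ℕ) (ρ : ℤ) :
    Above m n ρ (List.replicate e false) ↔ 0 ≤ ρ - e * n := by
  induction e generalizing ρ with
  | zero => simp [Above]
  | succ e ih =>
    rw [List.replicate_succ, Above, ih]
    push_cast
    have : (0 : ℤ) ≤ e * n := by positivity
    constructor
    · rintro ⟨-, h⟩
      simp at h
      linarith
    · intro h
      refine ⟨by nlinarith, ?_⟩
      simp
      linarith

lemma rets_replicate_true (m n a : ℕ) {ρ : ℤ} (hρ : 0 ≤ ρ) (hmn : n ≤ m) (ha : 0 < a) :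
    rets m n ρ (List.replicate a true) = if ρ < n then 1 else 0 := by
  have key : ∀ (b : ℕ) (σ : ℤ), (n : ℤ) ≤ σ → rets m n σ (List.replicate b true) = 0 := by
    intro b
    induction b with
    | zero => simp [rets]
    | succ b ih =>
      intro σ h
      rw [List.replicate_succ, rets, ih _ (by simp; omega), if_neg (by omega)]
  obtain ⟨b, rfl⟩ : ∃ b, a = b + 1 := ⟨a - 1, by omega⟩
  rw [List.replicate_succ, rets, key _ _ (by simp; omega), add_zero]

lemma rets_replicate_false (m n e : ℕ) {ρ : ℤ} (h : 0 ≤ ρ - e * n) :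
    rets m n ρ (List.replicate e false) = 0 := by
  induction e generalizing ρ with
  | zero => simp [rets]
  | succ e ih =>
    push_cast at h
    have : (0 : ℤ) ≤ e * n := by positivity
    rw [List.replicate_succ, rets, ih (by simp; linarith), if_neg (by nlinarith)]

lemma prefRank_append (m n : ℕ) (P Q : Path) :
    prefRank m n (P ++ Q) = prefRank m n P + prefRank m n Q := by
  simp [prefRank]; ring

lemma prefRank_replicate_true (m n a : ℕ) :
    prefRank m n (List.replicate a true) = a * m := by
  simp [prefRank, List.count_replicate]

lemma prefRank_replicate_false (m n e : ℕ) :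
    prefRank m n (List.replicate e false) = -(e * n) := by
  simp [prefRank, List.count_replicate]

lemma coarea_cons (b : Bool) (P : Path) :
    coarea (b :: P) = (if b then [0] else []) ++
      (coarea P).map (· + if b then 0 else 1) := by
  unfold coarea
  rw [List.length_cons, List.range_succ_eq_map, List.filterMap_cons, List.filterMap_map,
    List.map_filterMap]
  cases b <;> simp [apply_ite]

lemma mem_coarea_append (P Q : Path) (x : ℕ) :
    x ∈ coarea (P ++ Q) ↔ x ∈ coarea P ∨ ∃ y ∈ coarea Q, x = y + P.count false := by
  induction P generalizing x with
  | nil => simp [coarea]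
  | cons b P ih =>
    simp only [List.cons_append, coarea_cons, List.mem_append, List.mem_map, ih]
    cases b <;> simp <;> grind

lemma compType_append_false (P Q : Path) :
    compType (P ++ false :: Q) = compType P ++ compType Q := by
  unfold compType
  rw [List.splitOn_append_cons_self]
  simp

lemma compType_replicate_true (a : ℕ) :
    compType (List.replicate a true) = if a = 0 then [] else [a] := by
  have : (List.replicate a true).splitOn false = [List.replicate a true] :=
    List.splitOn_eq_singleton (by simp)
  simp [compType, this]
  split_ifs <;> simp [*]

/-- The path whose maximal blocks of north steps have lengths `α` and whose `i`-th such block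
(counting from `0`) is in column `i + g i`, if the `0`-th one is in column `g 0`. -/
def toPath : List ℕ → (ℕ → ℕ) → Path
  | [], _ => []
  | a :: α, g => List.replicate a true ++
      (List.replicate (g 1 - g 0 + 1) false ++ toPath α fun i => g (i + 1))

lemma toPath_append (α β : List ℕ) (g : ℕ → ℕ) :
    toPath (α ++ β) g = toPath α g ++ toPath β fun i => g (i + α.length) := by
  induction α generalizing g with
  | nil => rfl
  | cons a α ih => simp [toPath, ih, add_assoc, add_comm]

lemma toPath_eq_toPath_zero (α : List ℕ) (g : ℕ → ℕ) (hα : α ≠ [])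
    (hg : ∀ i < α.length, g i = 0) :
    toPath α g = toPath α 0 ++ List.replicate (g α.length) false := by
  induction α generalizing g with
  | nil => exact absurd rfl hα
  | cons a α ih =>
    have h0 : g 0 = 0 := hg 0 (by simp)
    rcases eq_or_ne α [] with rfl | hne
    · simp [toPath, h0, List.replicate_succ]
    · have h1 : g 1 = 0 := hg 1 (by simpa using List.length_pos_iff.2 hne)
      rw [toPath, ih _ hne fun i hi => hg (i + 1) (by simpa using hi)]
      simp [toPath, h0, h1]
      rfl

lemma count_true_toPath (α : List ℕ) (g : ℕ → ℕ) : (toPath α g).count true = α.sum := by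
  induction α generalizing g with
  | nil => rfl
  | cons a α ih => simp [toPath, ih, List.count_replicate]

lemma count_false_toPath (α : List ℕ) {g : ℕ → ℕ} (hg : Monotone g) :
    (toPath α g).count false + g 0 = α.length + g α.length := by
  induction α generalizing g with
  | nil => simp [toPath]
  | cons a α ih =>
    have := ih (g := fun i => g (i + 1)) fun i j h => hg (by omega)
    have h01 : g 0 ≤ g 1 := hg (by omega)
    simp [toPath, List.count_replicate] at this ⊢
    omega

lemma compType_toPath {α : List ℕ} (hα : ∀ a ∈ α, 0 < a) (g : ℕ → ℕ) :
    compType (toPath α g) = α := by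
  have key : ∀ e P, compType (List.replicate e false ++ P) = compType P := by
    intro e P
    induction e with
    | zero => rfl
    | succ e ih =>
      rw [List.replicate_succ, ← ih]
      exact compType_append_false [] (List.replicate e false ++ P)
  induction α generalizing g with
  | nil => rfl
  | cons a α ih =>
    have ha : a ≠ 0 := (hα a (by simp)).ne'
    rw [toPath, List.replicate_succ, List.cons_append, compType_append_false, key,
      ih fun b hb => hα b (by simp [hb]), compType_replicate_true]
    simp [ha]

lemma mem_coarea_replicate_true (a x : ℕ) :
    x ∈ coarea (List.replicate a true) ↔ 0 < a ∧ x = 0 := by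
  induction a with
  | zero => simp [coarea]
  | succ a ih => simp [List.replicate_succ, coarea_cons, ih]

lemma mem_coarea_toPath_zero {α : List ℕ} (hα : ∀ a ∈ α, 0 < a) (x : ℕ) :
    x ∈ coarea (toPath α 0) ↔ x < α.length := by
  induction α generalizing x with
  | nil => simp [toPath, coarea]
  | cons a α ih =>
    have ha : 0 < a := hα a (by simp)
    have ih' := ih fun b hb => hα b (by simp [hb])
    have h0 : (fun _ => 0 : ℕ → ℕ) = 0 := rfl
    simp [toPath, mem_coarea_append, mem_coarea_replicate_true, coarea_cons, h0, ih', ha,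
      List.count_replicate]
    constructor
    · rintro (rfl | ⟨y, hy, rfl⟩) <;> omega
    · intro h
      rcases x with _ | x
      · simp
      · exact .inr ⟨x, by omega, rfl⟩

lemma runStat_toPath_zero_append {α : List ℕ} (hα : ∀ a ∈ α, 0 < a) (hne : α ≠ []) (T : Path) :
    runStat (toPath α 0 ++ false :: T) = α.length := by
  have hcf : (toPath α 0).count false = α.length := by
    simpa using count_false_toPath α (g := 0) fun _ _ _ => le_rfl
  have hsum : α.length ≤ α.sum := by
    simpa using List.length_le_sum_of_one_le α hα
  have hpos := List.length_pos_iff.2 hne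
  have hmem : ∀ x, x ∈ coarea (toPath α 0 ++ false :: T) ↔
      x < α.length ∨ ∃ y ∈ coarea T, x = y + 1 + α.length := by
    intro x
    simp [mem_coarea_append, mem_coarea_toPath_zero hα, coarea_cons, hcf]
  refine le_antisymm (Nat.sInf_le ⟨hpos, ?_, ?_⟩) (le_csInf ⟨α.length, hpos, ?_, ?_⟩ ?_)
  · simp [count_true_toPath]; omega
  · rw [hmem]; rintro (h | ⟨y, -, h⟩) <;> omega
  · simp [count_true_toPath]; omega
  · rw [hmem]; rintro (h | ⟨y, -, h⟩) <;> omega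
  · rintro x ⟨-, -, hx⟩
    by_contra! h
    exact hx ((hmem x).2 (.inl h))

lemma toPath_eq_append {α : List ℕ} {g : ℕ → ℕ} {k : ℕ} (hk : 0 < k) (hkl : k ≤ α.length)
    (h0 : ∀ i < k, g i = 0) (hpos : 0 < g k) :
    toPath α g = toPath (α.take k) 0 ++ false ::
      (List.replicate (g k - 1) false ++ toPath (α.drop k) fun i => g (i + k)) := by
  have hl : (α.take k).length = k := by simpa using hkl
  conv_lhs => rw [← List.take_append_drop k α, toPath_append, hl]
  rw [toPath_eq_toPath_zero _ _ (by rw [← List.length_pos_iff]; omega) (by rwa [hl]), hl]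
  obtain ⟨e, he⟩ : ∃ e, g k = e + 1 := ⟨g k - 1, by omega⟩
  simp [he, List.replicate_succ]

lemma runStat_toPath {α : List ℕ} (hα : ∀ a ∈ α, 0 < a) {g : ℕ → ℕ} {k : ℕ} (hk : 0 < k)
    (hkl : k ≤ α.length) (h0 : ∀ i < k, g i = 0) (hpos : 0 < g k) :
    runStat (toPath α g) = k := by
  rw [toPath_eq_append hk hkl h0 hpos, runStat_toPath_zero_append]
  · simpa using hkl
  · exact fun a ha => hα a (List.mem_of_mem_take ha)
  · rw [← List.length_pos_iff]; simp; omega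

lemma runStat_toPath_iff {α : List ℕ} (hα : ∀ a ∈ α, 0 < a) {g : ℕ → ℕ} {k : ℕ} (hk : 0 < k)
    (hkl : k ≤ α.length) (hg0 : g 0 = 0) (hgl : 0 < g α.length) :
    runStat (toPath α g) = k ↔ (∀ i < k, g i = 0) ∧ 0 < g k := by
  refine ⟨?_, fun h => runStat_toPath hα hk hkl h.1 h.2⟩
  have hex : ∃ i, 0 < g i := ⟨_, hgl⟩
  have hmin : ∀ i < Nat.find hex, g i = 0 := fun i hi => by simpa using Nat.find_min hex hi
  have hf : 0 < Nat.find hex := by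
    by_contra! h
    have := Nat.find_spec hex
    rw [Nat.le_zero.1 h] at this
    omega
  rw [runStat_toPath hα hf (Nat.find_le hgl) hmin (Nat.find_spec hex)]
  rintro rfl
  exact ⟨hmin, Nat.find_spec hex⟩

lemma takeWhile_toPath {α : List ℕ} (hα : ∀ a ∈ α, 0 < a) (g : ℕ → ℕ) :
    (toPath α g).takeWhile (!·) = [] := by
  cases α with
  | nil => rfl
  | cons a α =>
    obtain ⟨b, rfl⟩ : ∃ b, a = b + 1 := ⟨a - 1, by have := hα a (by simp); omega⟩
    simp [toPath, List.replicate_succ]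

lemma toPath_injective {α : List ℕ} (hα : ∀ a ∈ α, 0 < a) {g g' : ℕ → ℕ} (hg : Monotone g)
    (hg' : Monotone g') (h0 : g 0 = g' 0) (h : toPath α g = toPath α g') :
    ∀ i ≤ α.length, g i = g' i := by
  induction α generalizing g g' with
  | nil => simpa using h0
  | cons a α ih =>
    have hα' : ∀ b ∈ α, 0 < b := fun b hb => hα b (by simp [hb])
    simp only [toPath, List.append_cancel_left_eq] at h
    have h1 := congrArg (fun P => (List.takeWhile (!·) P).length) h
    simp [takeWhile_toPath hα'] at h1
    have m1 : g 0 ≤ g 1 := hg (by omega)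
    have m2 : g' 0 ≤ g' 1 := hg' (by omega)
    have h2 : g 1 = g' 1 := by omega
    rw [h0, h2, List.append_cancel_left_eq] at h
    have := ih hα' (g := fun i => g (i + 1)) (g' := fun i => g' (i + 1))
      (fun i j hij => hg (by omega)) (fun i j hij => hg' (by omega)) h2 h
    rintro (_ | i) hi
    · exact h0
    · exact this i (by simpa using hi)

lemma exists_eq_toPath (P : Path) (hP : P ≠ [] → P.getLast? = some false) (c : ℕ) :
    ∃ g : ℕ → ℕ, Monotone g ∧ c ≤ g 0 ∧
      (∀ i, (compType P).length ≤ i → g i = g (compType P).length) ∧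
      P = List.replicate (g 0 - c) false ++ toPath (compType P) g := by
  induction hN : P.length using Nat.strong_induction_on generalizing P c with
  | _ N ih =>
  subst hN
  by_cases hf : false ∈ P
  · obtain ⟨A, Q, rfl, hA⟩ := List.eq_append_cons_of_mem hf
    have hA' : A = List.replicate A.length true := by
      rw [List.eq_replicate_iff]
      refine ⟨rfl, fun b hb => ?_⟩
      cases b
      · exact absurd hb hA
      · rfl
    obtain ⟨a, rfl⟩ : ∃ a, A = List.replicate a true := ⟨_, hA'⟩
    have hQ : Q ≠ [] → Q.getLast? = some false := by
      intro hne
      simpa [List.getLast?_append, List.getLast?_cons, List.getLast?_eq_some_getLast hne] using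
        hP (by simp)
    rw [compType_append_false, compType_replicate_true]
    split_ifs with ha
    · subst ha
      obtain ⟨g, hg, hc, hl, he⟩ := ih Q.length (by simp) Q hQ (c + 1) rfl
      refine ⟨g, hg, by omega, hl, ?_⟩
      rw [show g 0 - c = g 0 - (c + 1) + 1 by omega, List.replicate_succ]
      simpa using he
    · obtain ⟨g, hg, hc, hl, he⟩ := ih Q.length (by simp; omega) Q hQ c rfl
      refine ⟨fun i => Nat.casesOn i c g, ?_, le_rfl, ?_, ?_⟩
      · refine monotone_nat_of_le_succ ?_
        rintro (_ | i)
        · exact hc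
        · exact hg (by omega)
      · rintro (_ | i) hi
        · simp at hi
        · simpa using hl i (by simpa using hi)
      · simpa [toPath, List.replicate_succ] using he
  · have : P = [] := by
      by_contra hne
      exact hf (List.mem_of_getLast? (hP hne))
    subst this
    exact ⟨fun _ => c, fun _ _ _ => le_rfl, le_rfl, fun _ _ => rfl, by simp [compType, toPath]⟩

lemma prefRank_toPath (m n : ℕ) (α : List ℕ) {g : ℕ → ℕ} (hg : Monotone g) :
    prefRank m n (toPath α g) = α.sum * m - (α.length + g α.length - g 0) * n := by
  have h := count_false_toPath α hg
  have : ((toPath α g).count false : ℤ) = α.length + g α.length - g 0 := by omega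
  rw [prefRank, count_true_toPath, this]

lemma above_toPath (m n : ℕ) (α : List ℕ) {g : ℕ → ℕ} (hg : Monotone g) (ρ : ℤ) :
    Above m n ρ (toPath α g) ↔
      ∀ i ≤ α.length, 0 ≤ ρ + (α.take i).sum * m - (i + g i - g 0) * n := by
  induction α generalizing g ρ with
  | nil => simp [toPath, Above]
  | cons a α ih =>
    have h01 : g 0 ≤ g 1 := hg (by omega)
    have ih' := fun σ => ih (g := fun i => g (i + 1)) (fun i j h => hg (by omega)) σ
    rw [toPath, above_append, above_append, ih', prefRank_replicate_true,
      prefRank_replicate_false, above_replicate_false]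
    have hρ : ∀ i, ρ + a * m + -((g 1 - g 0 + 1 : ℕ) * n : ℤ) + (α.take i).sum * m -
        (i + g (i + 1) - g (0 + 1)) * n =
        ρ + ((a :: α).take (i + 1)).sum * m - ((i + 1 : ℕ) + g (i + 1) - g 0) * n := by
      intro i
      push_cast [Nat.cast_sub h01, List.take_succ_cons, List.sum_cons]
      ring
    simp only [hρ]
    constructor
    · rintro ⟨h, -, h'⟩ (_ | i) hi
      · simpa using h.nonneg
      · exact h' i (by simpa using hi)
    · intro h
      have h0 : 0 ≤ ρ := by simpa using h 0 (by simp)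
      refine ⟨above_replicate_true _ _ _ h0, ?_, fun i hi => h (i + 1) (by simpa using hi)⟩
      have := h 1 (by simp)
      rw [← hρ 0] at this
      simpa [sub_eq_add_neg] using this

lemma rets_toPath {m n : ℕ} (hmn : n ≤ m) {α : List ℕ} (hα : ∀ a ∈ α, 0 < a) {g : ℕ → ℕ}
    (hg : Monotone g) {ρ : ℤ} (h : Above m n ρ (toPath α g)) :
    rets m n ρ (toPath α g) = ((Finset.range α.length).filter fun i =>
      ρ + (α.take i).sum * m - (i + g i - g 0) * n < (n : ℤ)).card := by
  rw [Finset.card_filter]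
  induction α generalizing g ρ with
  | nil => simp [toPath, rets]
  | cons a α ih =>
    have h01 : g 0 ≤ g 1 := hg (by omega)
    have hρ : ∀ i, ρ + a * m + -((g 1 - g 0 + 1 : ℕ) * n : ℤ) + (α.take i).sum * m -
        (i + g (i + 1) - g (0 + 1)) * n =
        ρ + ((a :: α).take (i + 1)).sum * m - ((i + 1 : ℕ) + g (i + 1) - g 0) * n := by
      intro i
      push_cast [Nat.cast_sub h01, List.take_succ_cons, List.sum_cons]
      ring
    have h0 := h.nonneg
    rw [toPath, above_append, above_append, prefRank_replicate_true,
      prefRank_replicate_false] at h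
    obtain ⟨-, h2, h3⟩ := h
    rw [above_replicate_false] at h2
    rw [toPath, rets_append, rets_append, rets_replicate_true _ _ _ h0 hmn (hα a (by simp)),
      prefRank_replicate_true, rets_replicate_false _ _ _ h2, prefRank_replicate_false,
      ih (fun b hb => hα b (by simp [hb])) (fun i j h => hg (by omega)) h3]
    simp only [hρ]
    rw [List.length_cons, Finset.sum_range_succ']
    simp [add_comm]

/-- Monotone sequences bounded by `G`, equal to `G` from index `l` on, with exactly `k` initial
zeros and exactly `j` indices below `l` at which `G` is attained. -/
def boundedSeqs (l : ℕ) (G : ℕ → ℕ) (k j : ℕ) : Set (ℕ → ℕ) :=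
  {g | Monotone g ∧ (∀ i, g i ≤ G i) ∧ (∀ i, l ≤ i → g i = G i) ∧ (∀ i < k, g i = 0) ∧ 0 < g k ∧
    ((Finset.range l).filter fun i => g i = G i).card = j}

/-- `g'` arises from `g` by deleting the entry at `p`, the first index from `k` on at which `G` is
attained, and inserting a zero at `k`. -/
structure ShiftsTo (G : ℕ → ℕ) (k p : ℕ) (g g' : ℕ → ℕ) : Prop where
  le : k ≤ p
  zero : ∀ i < k, g i = 0
  zero' : ∀ i ≤ k, g' i = 0
  shift : ∀ i, k ≤ i → i < p → g' (i + 1) = g i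
  lt : ∀ i, k ≤ i → i < p → g i < G i
  attained : g p = G p
  eq : ∀ i, p < i → g' i = g i

namespace ShiftsTo

variable {G : ℕ → ℕ} {k p : ℕ} {g g' : ℕ → ℕ}

lemma lt_of_le (h : ShiftsTo G k p g g') (hG : Monotone G) (hGk : 0 < G k) {i : ℕ} (hki : k ≤ i)
    (hip : i ≤ p) : g' i < G i := by
  rcases hki.eq_or_lt with rfl | hlt
  · rwa [h.zero' _ le_rfl]
  · obtain ⟨i, rfl⟩ : ∃ i', i = i' + 1 := ⟨i - 1, by omega⟩
    rw [h.shift i (by omega) (by omega)]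
    exact (h.lt i (by omega) (by omega)).trans_le (hG (by omega))

lemma card_filter (h : ShiftsTo G k p g g') (hG : Monotone G) (hGk : 0 < G k) {l : ℕ}
    (hp : p < l) : ((Finset.range l).filter fun i => g i = G i).card =
      ((Finset.range l).filter fun i => g' i = G i).card + 1 := by
  rw [← Finset.card_insert_of_notMem (a := p)]
  · congr 1
    ext i
    simp only [Finset.mem_filter, Finset.mem_range, Finset.mem_insert]
    rcases lt_or_ge i k with hi | hi
    · rw [h.zero i hi, h.zero' i hi.le]
      have := h.le
      omega
    · rcases lt_trichotomy i p with hip | rfl | hip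
      · have h1 := h.lt i hi hip
        have h2 := h.lt_of_le hG hGk hi hip.le
        omega
      · simp [hp, h.attained]
      · rw [h.eq i hip]
        omega
  · have := h.lt_of_le hG hGk h.le le_rfl
    simp
    omega

lemma pos (h : ShiftsTo G k p g g') (hGk : 0 < G k) (hg' : 0 < g' (k + 1)) : 0 < g k := by
  rcases h.le.eq_or_lt with rfl | hlt
  · rwa [h.attained]
  · rwa [← h.shift k le_rfl hlt]

lemma pos' (h : ShiftsTo G k p g g') (hg : Monotone g) (hgk : 0 < g k) : 0 < g' (k + 1) := by
  rcases h.le.eq_or_lt with rfl | hlt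
  · rw [h.eq _ (by omega)]
    exact hgk.trans_le (hg (by omega))
  · rwa [h.shift k le_rfl hlt]

lemma le_succ (h : ShiftsTo G k p g g') (hg : Monotone g) : G p ≤ g' (p + 1) := by
  rw [← h.attained, h.eq _ (by omega)]
  exact hg (by omega)

lemma index_le {p₂ : ℕ} {g₂ : ℕ → ℕ} (h : ShiftsTo G k p g g') (h₂ : ShiftsTo G k p₂ g₂ g')
    (hg : Monotone g) : p₂ ≤ p := by
  by_contra! hlt
  have h1 := h.le_succ hg
  rw [h₂.shift p h.le hlt] at h1
  exact absurd (h₂.lt p h.le hlt) (by omega)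

lemma left_unique {p₂ : ℕ} {g₂ : ℕ → ℕ} (h : ShiftsTo G k p g g') (h₂ : ShiftsTo G k p₂ g₂ g')
    (hg : Monotone g) (hg₂ : Monotone g₂) : g = g₂ := by
  obtain rfl : p = p₂ := le_antisymm (h₂.index_le h hg₂) (h.index_le h₂ hg)
  ext i
  rcases lt_or_ge i k with hi | hi
  · rw [h.zero i hi, h₂.zero i hi]
  · rcases lt_trichotomy i p with hip | rfl | hip
    · rw [← h.shift i hi hip, ← h₂.shift i hi hip]
    · rw [h.attained, h₂.attained]
    · rw [← h.eq i hip, ← h₂.eq i hip]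

lemma right_unique {p₂ : ℕ} {g₂ : ℕ → ℕ} (h : ShiftsTo G k p g g') (h₂ : ShiftsTo G k p₂ g g₂) :
    g' = g₂ := by
  obtain rfl : p = p₂ := by
    refine le_antisymm (not_lt.1 fun hlt => ?_) (not_lt.1 fun hlt => ?_)
    · exact (h.lt _ h₂.le hlt).ne h₂.attained
    · exact (h₂.lt _ h.le hlt).ne h.attained
  ext i
  rcases le_or_gt i k with hi | hi
  · rw [h.zero' i hi, h₂.zero' i hi]
  · rcases le_or_gt i p with hip | hip
    · obtain ⟨i, rfl⟩ : ∃ i', i = i' + 1 := ⟨i - 1, by omega⟩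
      rw [h.shift i (by omega) (by omega), h₂.shift i (by omega) (by omega)]
    · rw [h.eq i hip, h₂.eq i hip]

end ShiftsTo

lemma exists_shiftsTo_right {l : ℕ} {G : ℕ → ℕ} (hG : Monotone G) {k j : ℕ} (hGk : 0 < G k)
    (hj : ((Finset.range k).filter fun i => G i = 0).card ≤ j) {g : ℕ → ℕ}
    (hg : g ∈ boundedSeqs l G k (j + 1)) :
    ∃ g' ∈ boundedSeqs l G (k + 1) j, ∃ p, ShiftsTo G k p g g' := by
  obtain ⟨hm, hle, hl, h0, hpos, hc⟩ := hg
  have hex : ∃ p, k ≤ p ∧ p < l ∧ g p = G p := by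
    by_contra! hno
    have : ((Finset.range l).filter fun i => g i = G i) ⊆
        (Finset.range k).filter fun i => G i = 0 := by
      intro i hi
      simp only [Finset.mem_filter, Finset.mem_range] at hi ⊢
      rcases lt_or_ge i k with hik | hik
      · exact ⟨hik, by rw [← hi.2, h0 i hik]⟩
      · exact absurd hi.2 (hno i hik hi.1)
    have := Finset.card_le_card this
    omega
  obtain ⟨hkp, hpl, hgp⟩ := Nat.find_spec hex
  have hmin := fun i (hi : i < Nat.find hex) => Nat.find_min hex hi
  generalize Nat.find hex = p at *
  have hlt : ∀ i, k ≤ i → i < p → g i < G i := fun i hki hip =>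
    lt_of_le_of_ne (hle i) fun he => hmin i hip ⟨hki, by omega, he⟩
  let g' : ℕ → ℕ := fun i => if i ≤ k then 0 else if i ≤ p then g (i - 1) else g i
  have hs : ShiftsTo G k p g g' := by
    refine ⟨hkp, h0, fun i hi => by simp [g', hi], fun i hi hip => ?_, hlt, hgp, fun i hi => ?_⟩
    · simp [g', show ¬ i + 1 ≤ k by omega, show i + 1 ≤ p by omega]
    · simp [g', show ¬ i ≤ k by omega, show ¬ i ≤ p by omega]
  refine ⟨g', ⟨?_, ?_, ?_, fun i hi => hs.zero' i (by omega), hs.pos' hm hpos, ?_⟩, p, hs⟩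
  · refine monotone_nat_of_le_succ fun i => ?_
    have h1 : g i ≤ g (i + 1) := hm (by omega)
    have h2 : g (i - 1) ≤ g i := hm (by omega)
    simp only [g', Nat.add_sub_cancel]
    split_ifs <;> omega
  · intro i
    have h1 : g (i - 1) ≤ g i := hm (by omega)
    have h2 := hle i
    simp only [g']
    split_ifs <;> omega
  · intro i hi
    rw [hs.eq i (by omega), hl i hi]
  · have := hs.card_filter hG hGk hpl
    omega

lemma exists_shiftsTo_left {l : ℕ} {G : ℕ → ℕ} (hG : Monotone G) {k j : ℕ} (hkl : k < l)
    (hGk : 0 < G k) {g' : ℕ → ℕ} (hg : g' ∈ boundedSeqs l G (k + 1) j) :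
    ∃ g ∈ boundedSeqs l G k (j + 1), ∃ p, ShiftsTo G k p g g' := by
  obtain ⟨hm, hle, hl, h0, hpos, hc⟩ := hg
  have hex : ∃ p, k ≤ p ∧ p < l ∧ G p ≤ g' (p + 1) := by
    refine ⟨l - 1, by omega, by omega, ?_⟩
    rw [hl _ (by omega)]
    exact hG (by omega)
  obtain ⟨hkp, hpl, hgp⟩ := Nat.find_spec hex
  have hmin := fun i (hi : i < Nat.find hex) => Nat.find_min hex hi
  generalize Nat.find hex = p at *
  have hlt : ∀ i, k ≤ i → i < p → g' (i + 1) < G i := fun i hki hip => by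
    by_contra! h
    exact hmin i hip ⟨hki, by omega, h⟩
  let g : ℕ → ℕ := fun i => if i < k then 0 else if i < p then g' (i + 1) else
    if i = p then G p else g' i
  have hs : ShiftsTo G k p g g' := by
    refine ⟨hkp, fun i hi => by simp [g, hi], fun i hi => h0 i (by omega),
      fun i hi hip => ?_, fun i hi hip => ?_, ?_, fun i hi => ?_⟩
    · simp [g, show ¬ i < k by omega, hip]
    · simpa [g, show ¬ i < k by omega, hip] using hlt i hi hip
    · simp [g, show ¬ p < k by omega]
    · simp [g, show ¬ i < k by omega, show ¬ i < p by omega, show i ≠ p by omega]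
  refine ⟨g, ⟨?_, ?_, ?_, hs.zero, hs.pos hGk hpos, ?_⟩, p, hs⟩
  · refine monotone_nat_of_le_succ fun i => ?_
    rcases lt_or_ge i k with hi | hi
    · simp [hs.zero i hi]
    · rcases lt_trichotomy i p with hip | rfl | hip
      · rcases (show i + 1 ≤ p by omega).eq_or_lt with rfl | hip'
        · rw [hs.attained]
          exact (hs.lt i hi hip).le.trans (hG (by omega))
        · rw [← hs.shift i hi hip, ← hs.shift (i + 1) (by omega) hip']
          exact hm (by omega)
      · rw [hs.attained, ← hs.eq (i + 1) (by omega)]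
        exact hgp
      · rw [← hs.eq i hip, ← hs.eq (i + 1) (by omega)]
        exact hm (by omega)
  · intro i
    rcases lt_or_ge i k with hi | hi
    · simp [hs.zero i hi]
    · rcases lt_trichotomy i p with hip | rfl | hip
      · exact (hs.lt i hi hip).le
      · exact hs.attained.le
      · rw [← hs.eq i hip]
        exact hle i
  · intro i hi
    rw [← hs.eq i (by omega), hl i hi]
  · rw [hs.card_filter hG hGk hpl, hc]

lemma ncard_boundedSeqs_succ {l : ℕ} {G : ℕ → ℕ} (hG : Monotone G) {k j : ℕ} (hkl : k < l)
    (hGk : 0 < G k) (hj : ((Finset.range k).filter fun i => G i = 0).card ≤ j) :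
    (boundedSeqs l G k (j + 1)).ncard = (boundedSeqs l G (k + 1) j).ncard := by
  choose! f hf p hp using fun g (hg : g ∈ boundedSeqs l G k (j + 1)) =>
    exists_shiftsTo_right hG hGk hj hg
  refine Set.ncard_congr (fun g _ => f g) hf ?_ ?_
  · intro g g₂ hg hg₂ he
    have h₂ := hp g₂ hg₂
    rw [← he] at h₂
    exact (hp g hg).left_unique h₂ hg.1 hg₂.1
  · intro g' hg'
    obtain ⟨g, hg, q, hq⟩ := exists_shiftsTo_left hG hkl hGk hg'
    exact ⟨g, hg, (hp g hg).right_unique hq⟩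

/-- The largest possible value at `i` of a sequence encoding a Dyck path of composition type `α`. -/
def seqBound (m : ℕ) (α : List ℕ) (i : ℕ) : ℕ :=
  (α.take (min i α.length)).sum * m / α.sum - min i α.length

lemma IsComposition.le_sum_take {n : ℕ} {α : List ℕ} (hα : IsComposition n α) {i : ℕ}
    (hi : i ≤ α.length) : i ≤ (α.take i).sum := by
  simpa [hi] using List.length_le_sum_of_one_le (α.take i) fun a ha =>
    hα.1 a (List.mem_of_mem_take ha)

section

variable {m n : ℕ} {α : List ℕ}

lemma le_seqBound_iff (hn : 0 < n) (hmn : n < m) (hα : IsComposition n α) {i : ℕ}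
    (hi : i ≤ α.length) (x : ℕ) : x ≤ seqBound m α i ↔ (i + x) * n ≤ (α.take i).sum * m := by
  have h1 := hα.le_sum_take hi
  have h2 : i ≤ (α.take i).sum * m / n := by
    rw [Nat.le_div_iff_mul_le hn]
    exact Nat.mul_le_mul h1 hmn.le
  rw [seqBound, min_eq_left hi, hα.2, Nat.le_sub_iff_add_le h2, Nat.le_div_iff_mul_le hn, add_comm]

lemma le_seqBound_iff_int (hn : 0 < n) (hmn : n < m) (hα : IsComposition n α) {i : ℕ}
    (hi : i ≤ α.length) (x : ℕ) :
    x ≤ seqBound m α i ↔ ((i : ℤ) + (x : ℕ)) * n ≤ ((α.take i).sum : ℕ) * m := by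
  rw [le_seqBound_iff hn hmn hα hi]
  norm_cast

lemma seqBound_of_le (hn : 0 < n) (hα : IsComposition n α) {i : ℕ} (hi : α.length ≤ i) :
    seqBound m α i = m - α.length := by
  rw [seqBound, min_eq_right hi, List.take_length, hα.2, Nat.mul_div_cancel_left _ hn]

lemma monotone_seqBound (hn : 0 < n) (hmn : n < m) (hα : IsComposition n α) :
    Monotone (seqBound m α) := by
  refine monotone_nat_of_le_succ fun i => ?_
  rcases lt_or_ge i α.length with hi | hi
  · rw [le_seqBound_iff hn hmn hα hi]
    have h1 := (le_seqBound_iff hn hmn hα hi.le _).1 le_rfl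
    have h2 : 0 < α[i] := hα.1 _ (List.getElem_mem hi)
    rw [List.sum_take_succ _ _ hi]
    nlinarith
  · rw [seqBound_of_le hn hα hi, seqBound_of_le hn hα (by omega)]

lemma sum_take_of_le_iones {i : ℕ} (hi : i ≤ iones α) : (α.take i).sum = i := by
  induction α generalizing i with
  | nil => simp [iones] at hi; simp [hi]
  | cons a α ih =>
    rcases i with _ | i
    · simp
    · by_cases ha : a = 1
      · have := @ih i (by simpa [iones, ha] using hi)
        simp [this, ha, add_comm]
      · simp [iones, ha] at hi

lemma lt_sum_take_of_iones_lt (hα : ∀ a ∈ α, 0 < a) {i : ℕ} (hi : iones α < i)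
    (hil : i ≤ α.length) : i < (α.take i).sum := by
  induction α generalizing i with
  | nil => simp at hil; omega
  | cons a α ih =>
    have hα' : ∀ b ∈ α, 0 < b := fun b hb => hα b (by simp [hb])
    obtain ⟨i, rfl⟩ : ∃ i', i = i' + 1 := ⟨i - 1, by omega⟩
    by_cases ha : a = 1
    · have := @ih hα' i (by simpa [iones, ha] using hi) (by simpa using hil)
      simp [ha]
      omega
    · have h1 : 0 < a := hα a (by simp)
      have h2 := IsComposition.le_sum_take (n := α.sum) ⟨hα', rfl⟩ (i := i) (by simpa using hil)
      simp
      omega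

lemma lt_rr_iff (hmn : n < m) (hα : IsComposition n α) (i : ℕ) :
    i < rr m α ↔ i ≤ iones α ∧ i * (m - n) < n := by
  have h : 0 < m - n := by omega
  have h' : i < (n + (m - n) - 1) / (m - n) ↔ (i + 1) * (m - n) ≤ n + (m - n) - 1 :=
    Nat.le_div_iff_mul_le h
  rw [rr, hα.2, lt_min_iff, Nat.lt_succ_iff, h', Nat.succ_mul]
  refine and_congr_right fun _ => ?_
  omega

lemma seqBound_eq_zero_iff (hn : 0 < n) (hmn : n < m) (hα : IsComposition n α) {i : ℕ}
    (hi : i ≤ α.length) : seqBound m α i = 0 ↔ i < rr m α := by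
  obtain ⟨d, rfl⟩ := Nat.exists_eq_add_of_lt hmn
  rw [lt_rr_iff hmn hα, show n + d + 1 - n = d + 1 by omega, ← not_iff_not, ← Ne,
    ← Nat.one_le_iff_ne_zero, le_seqBound_iff hn hmn hα hi, not_and_or, not_le, not_lt]
  rcases le_or_gt i (iones α) with h | h
  · rw [sum_take_of_le_iones h]
    simp only [not_lt.2 h, false_or]
    constructor <;> intro h <;> nlinarith
  · have := lt_sum_take_of_iones_lt hα.1 h hi
    simp only [h, true_or, iff_true]
    nlinarith

lemma card_seqBound_eq_zero (hn : 0 < n) (hmn : n < m) (hα : IsComposition n α) {k : ℕ}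
    (hk : rr m α ≤ k) (hkl : k ≤ α.length) :
    ((Finset.range k).filter fun i => seqBound m α i = 0).card = rr m α := by
  rw [← Finset.card_range (rr m α)]
  congr 1
  ext i
  simp only [Finset.mem_filter, Finset.mem_range]
  constructor
  · rintro ⟨h1, h2⟩
    exact (seqBound_eq_zero_iff hn hmn hα (by omega)).1 h2
  · intro h
    exact ⟨by omega, (seqBound_eq_zero_iff hn hmn hα (by omega)).2 h⟩

lemma mem_dyckPathsCompRR {k j : ℕ} {P : Path} : P ∈ dyckPathsCompRR m n α k j ↔
    P.count false = m ∧ P.count true = n ∧ Above m n 0 P ∧ compType P = α ∧ runStat P = k ∧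
      rets m n 0 P = j := by
  rw [dyckPathsCompRR, dyckPathsComp, dyckPaths, Finset.mem_filter, Finset.mem_filter,
    Finset.mem_filter, Finset.mem_image]
  simp only [Finset.mem_univ, true_and, IsDyck, above_iff, zero_add, retStat_eq_rets]
  constructor
  · tauto
  · rintro ⟨h1, h2, h⟩
    have hl : P.length = m + n := by rw [← h1, ← h2, List.count_false_add_count_true]
    refine ⟨⟨⟨?_, h1, h2, h.1⟩, h.2.1⟩, h.2.2⟩
    rw [← hl]
    exact ⟨P.get, List.ofFn_get P⟩

lemma toPath_mem_dyckPathsCompRR_iff (hn : 0 < n) (hmn : n < m) (hα : IsComposition n α)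
    {k j : ℕ} (hk : 0 < k) (hkl : k ≤ α.length) {g : ℕ → ℕ} (hg : Monotone g) (hg0 : g 0 = 0)
    (hgl : ∀ i, α.length ≤ i → g i = g α.length) :
    toPath α g ∈ dyckPathsCompRR m n α k j ↔ g ∈ boundedSeqs α.length (seqBound m α) k j := by
  have hlen : α.length ≤ n := by
    simpa [hα.2] using hα.le_sum_take le_rfl
  have hcf := count_false_toPath α hg
  have hA : Above m n 0 (toPath α g) ↔ ∀ i ≤ α.length, g i ≤ seqBound m α i := by
    rw [above_toPath _ _ _ hg]
    refine forall₂_congr fun i hi => ?_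
    rw [le_seqBound_iff_int hn hmn hα hi, hg0, Nat.cast_zero]
    constructor <;> intro h <;> linarith
  have hB : (∀ i, g i ≤ seqBound m α i) ∧ (∀ i, α.length ≤ i → g i = seqBound m α i) ↔
      (∀ i ≤ α.length, g i ≤ seqBound m α i) ∧ (toPath α g).count false = m := by
    have h1 : ∀ i, α.length ≤ i → (g i = seqBound m α i ↔ (toPath α g).count false = m) := by
      intro i hi
      rw [seqBound_of_le hn hα hi, hgl i hi]
      omega
    constructor
    · exact fun h => ⟨fun i _ => h.1 i, (h1 _ le_rfl).1 (h.2 _ le_rfl)⟩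
    · intro h
      refine ⟨fun i => ?_, fun i hi => (h1 i hi).2 h.2⟩
      rcases le_or_gt i α.length with hi | hi
      · exact h.1 i hi
      · exact ((h1 i hi.le).2 h.2).le
  rw [mem_dyckPathsCompRR]
  simp only [boundedSeqs, Set.mem_ofPred_eq, count_true_toPath, compType_toPath hα.1, hα.2,
    true_and, hg]
  rw [← and_assoc, hA, ← and_assoc (a := ∀ i, g i ≤ _), hB, and_comm (a := _ = m)]
  refine and_congr_right fun ⟨hle, hm⟩ => ?_
  rw [runStat_toPath_iff hα.1 hk hkl hg0 (by omega), and_assoc]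
  refine and_congr_right fun _ => and_congr_right fun _ => ?_
  rw [rets_toPath hmn.le hα.1 hg (hA.2 hle)]
  have : ∀ i ∈ Finset.range α.length, (0 + ((α.take i).sum : ℤ) * m - (i + g i - g 0) * n < n ↔
      g i = seqBound m α i) := by
    intro i hi
    have hil : i ≤ α.length := (Finset.mem_range.1 hi).le
    have h1 := hle i hil
    rw [hg0, show g i = seqBound m α i ↔ ¬ g i + 1 ≤ seqBound m α i by omega,
      le_seqBound_iff_int hn hmn hα hil, not_le, Nat.cast_zero, Nat.cast_succ]
    constructor <;> intro h <;> linarith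
  rw [Finset.filter_congr this]

lemma getLast?_of_above {ρ : ℤ} (hmn : n < m) {P : Path} (h : Above m n ρ P)
    (hρ : ρ + prefRank m n P = 0) : P ≠ [] → P.getLast? = some false := by
  intro hne
  obtain ⟨Q, b, rfl⟩ := List.eq_nil_or_concat P |>.resolve_left hne
  rw [List.concat_eq_append] at *
  cases b
  · simp
  · rw [above_append] at h
    have := h.2.nonneg
    simp [prefRank_append, prefRank_cons, prefRank_nil] at hρ
    omega

lemma prefRank_eq_zero {P : Path} (h1 : P.count false = m) (h2 : P.count true = n) :
    prefRank m n P = 0 := by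
  rw [prefRank, h1, h2]
  ring

lemma coe_dyckPathsCompRR (hn : 0 < n) (hmn : n < m) (hα : IsComposition n α)
    {k j : ℕ} (hk : 0 < k) (hkl : k ≤ α.length) :
    (dyckPathsCompRR m n α k j : Set Path) =
      toPath α '' boundedSeqs α.length (seqBound m α) k j := by
  have hmem := @toPath_mem_dyckPathsCompRR_iff m n α hn hmn hα k j hk hkl
  ext P
  simp only [Finset.mem_coe, Set.mem_image]
  constructor
  · intro hP
    obtain ⟨h1, h2, h3, rfl, -⟩ := mem_dyckPathsCompRR.1 hP
    obtain ⟨g, hg, -, hgl, he⟩ := exists_eq_toPath P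
      (getLast?_of_above hmn h3 (by rw [prefRank_eq_zero h1 h2, add_zero])) 0
    have hg0 : g 0 = 0 := by
      rw [he, above_append, above_replicate_false] at h3
      by_contra h
      have : 0 < (g 0 : ℤ) * n := by positivity
      simp at h3
      omega
    rw [hg0] at he
    have he' : toPath (compType P) g = P := by simpa using he.symm
    exact ⟨g, (hmem hg hg0 hgl).1 (by rwa [he']), he'⟩
  · rintro ⟨g, hg, rfl⟩
    refine (hmem hg.1 (hg.2.2.2.1 0 hk) fun i hi => ?_).2 hg
    rw [hg.2.2.1 i hi, hg.2.2.1 _ le_rfl, seqBound_of_le hn hα hi, seqBound_of_le hn hα le_rfl]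

lemma card_dyckPathsCompRR (hn : 0 < n) (hmn : n < m) (hα : IsComposition n α)
    {k j : ℕ} (hk : 0 < k) (hkl : k ≤ α.length) :
    (dyckPathsCompRR m n α k j).card = (boundedSeqs α.length (seqBound m α) k j).ncard := by
  rw [← Set.ncard_coe_finset, coe_dyckPathsCompRR hn hmn hα hk hkl]
  refine Set.InjOn.ncard_image fun g hg g' hg' he => ?_
  ext i
  rcases le_or_gt i α.length with hi | hi
  · exact toPath_injective hα.1 hg.1 hg'.1 (by rw [hg.2.2.2.1 0 hk, hg'.2.2.2.1 0 hk]) he i hi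
  · rw [hg.2.2.1 i hi.le, hg'.2.2.1 i hi.le]

lemma card_dyckPathsCompRR_add (hn : 0 < n) (hmn : n < m) (hα : IsComposition n α)
    {k d : ℕ} (hk : 0 < k) (hkr : rr m α ≤ k) (hkl : k + d ≤ α.length) :
    (dyckPathsCompRR m n α k (rr m α + d)).card =
      (dyckPathsCompRR m n α (k + d) (rr m α)).card := by
  induction d generalizing k with
  | zero => rfl
  | succ d ih =>
    have h0 := seqBound_eq_zero_iff hn hmn hα (i := k) (by omega)
    rw [show k + (d + 1) = k + 1 + d by omega, ← ih (by omega) (by omega) (by omega),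
      card_dyckPathsCompRR hn hmn hα hk (by omega), card_dyckPathsCompRR hn hmn hα (by omega)
      (by omega), ← add_assoc]
    refine ncard_boundedSeqs_succ (monotone_seqBound hn hmn hα) (by omega) (by omega) ?_
    rw [card_seqBound_eq_zero hn hmn hα hkr (by omega)]
    omega

lemma mem_tPaths {j : ℕ} {T : Path} : T ∈ tPaths m α j ↔
    T.count false + (j + 1) = m ∧ T.count true + (α.take j).sum = α.sum ∧
      Above m α.sum ((α.take j).sum * m - (j + 1) * α.sum) T ∧
      rets m α.sum ((α.take j).sum * m - (j + 1) * α.sum) T = 0 ∧ compType T = α.drop j := by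
  have hr : ∀ i, ptRank m α.sum (j + 1 + (T.take i).count false)
      ((α.take j).sum + (T.take i).count true) =
      ((α.take j).sum * m - (j + 1) * α.sum : ℤ) + prefRank m α.sum (T.take i) := by
    intro i
    simp [ptRank, prefRank]
    ring
  rw [tPaths, Finset.mem_filter, Finset.mem_image]
  simp only [Finset.mem_univ, true_and, IsTPath, hr, ← above_iff]
  generalize ((α.take j).sum * m - (j + 1) * α.sum : ℤ) = ρ
  have hN : Above m α.sum ρ T → ((∀ i < T.length, T.getD i false = true →
      (α.sum : ℤ) ≤ ρ + prefRank m α.sum (T.take i)) ↔ rets m α.sum ρ T = 0) := by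
    intro h
    rw [← length_filter_eq_rets, List.length_eq_zero_iff, List.filter_eq_nil_iff]
    simp only [List.mem_range, decide_eq_true_eq, not_lt]
    refine forall₂_congr fun i hi => ⟨fun h' => ?_, fun h' _ => h'⟩
    rcases hb : T[i] with _ | _
    · have := (above_iff _ _ _ _).1 h (i + 1) hi
      rw [List.take_succ_eq_append_getElem hi, prefRank_append, hb, prefRank_cons,
        prefRank_nil] at this
      simp [-Nat.cast_list_sum] at this
      linarith
    · exact h' (by rw [List.getD_eq_getElem _ _ hi, hb])
  constructor
  · rintro ⟨-, h1, h2, h3, h4, h5⟩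
    exact ⟨h1, h2, h3, (hN h3).1 h4, h5⟩
  · rintro ⟨h1, h2, h3, h4, h5⟩
    refine ⟨?_, h1, h2, h3, (hN h3).2 h4, h5⟩
    have hl : T.length = m - (j + 1) + (α.sum - (α.take j).sum) := by
      rw [← List.count_false_add_count_true]
      omega
    rw [← hl]
    exact ⟨T.get, List.ofFn_get T⟩

lemma append_mem_dyckPathsCompRR_iff (hn : 0 < n) (hmn : n < m) (hα : IsComposition n α)
    {k : ℕ} (hk : 0 < k) (hkr : rr m α ≤ k) (hkl : k ≤ α.length) (T : Path) :
    toPath (α.take k) 0 ++ false :: T ∈ dyckPathsCompRR m n α k (rr m α) ↔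
      T ∈ tPaths m α k := by
  have hm0 : Monotone (0 : ℕ → ℕ) := fun _ _ _ => le_rfl
  have hl : (α.take k).length = k := by simpa using hkl
  have htake : ∀ i ≤ k, (α.take k).take i = α.take i := fun i hi => by
    rw [List.take_take, min_eq_left hi]
  have hpos : ∀ a ∈ α.take k, 0 < a := fun a ha => hα.1 a (List.mem_of_mem_take ha)
  have hcf := count_false_toPath (α.take k) hm0
  have hz : ∀ i ≤ k, (i * n : ℤ) ≤ (α.take i).sum * m := by
    intro i hi
    simpa [-Nat.cast_list_sum] using
      (le_seqBound_iff_int hn hmn hα (hi.trans hkl) 0).1 (Nat.zero_le _)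
  have hA : Above m n 0 (toPath (α.take k) 0) := by
    rw [above_toPath _ _ _ hm0, hl]
    intro i hi
    have := hz i hi
    rw [htake i hi]
    simp [-Nat.cast_list_sum]
    linarith
  have hR : rets m n 0 (toPath (α.take k) 0) = rr m α := by
    rw [rets_toPath hmn.le hpos hm0 hA, hl, ← card_seqBound_eq_zero hn hmn hα hkr hkl]
    congr 1
    refine Finset.filter_congr fun i hi => ?_
    have hik : i ≤ k := (Finset.mem_range.1 hi).le
    rw [htake i hik, ← not_iff_not, ← Ne, ← Nat.one_le_iff_ne_zero,
      le_seqBound_iff_int hn hmn hα (hik.trans hkl), not_lt]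
    simp [-Nat.cast_list_sum]
    constructor <;> intro h <;> linarith
  have hrank : (n : ℤ) ≤ prefRank m n (toPath (α.take k) 0) := by
    have h0 := seqBound_eq_zero_iff hn hmn hα hkl
    have h1 := (le_seqBound_iff_int hn hmn hα hkl 1).1 (by omega)
    rw [prefRank_toPath _ _ _ hm0, hl]
    simp [-Nat.cast_list_sum] at h1 ⊢
    linarith
  have hrun : runStat (toPath (α.take k) 0 ++ false :: T) = k := by
    rw [runStat_toPath_zero_append hpos (by rw [← List.length_pos_iff]; omega), hl]
  have hrk : prefRank m n (toPath (α.take k) 0) - n = (α.take k).sum * m - (k + 1) * n := by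
    rw [prefRank_toPath _ _ _ hm0, hl]
    simp
    ring
  have hcomp : compType T = α.drop k ↔ compType (toPath (α.take k) 0 ++ false :: T) = α := by
    rw [compType_append_false, compType_toPath hpos]
    conv_rhs => rhs; rw [← List.take_append_drop k α]
    rw [List.append_cancel_left_eq]
  rw [mem_dyckPathsCompRR, mem_tPaths, ← hcomp, rets_append, above_append, hR, hrun, hα.2, ← hrk]
  simp [rets, Above, hA, not_lt.2 hrank, count_true_toPath, ← sub_eq_add_neg]
  simp at hcf
  have : 0 ≤ prefRank m n (toPath (α.take k) 0) := by omega
  have e1 : (toPath (α.take k) 0).count false + (T.count false + 1) = m ↔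
      T.count false + (k + 1) = m := by omega
  have e2 : (α.take k).sum + T.count true = n ↔ T.count true + (α.take k).sum = n := by omega
  tauto

lemma card_dyckPathsCompRR_eq_card_tPaths (hn : 0 < n) (hmn : n < m) (hα : IsComposition n α)
    {k : ℕ} (hk : 0 < k) (hkr : rr m α ≤ k) (hkl : k ≤ α.length) :
    (dyckPathsCompRR m n α k (rr m α)).card = (tPaths m α k).card := by
  have hmem := append_mem_dyckPathsCompRR_iff hn hmn hα hk hkr hkl
  symm
  refine Finset.card_bij (fun T _ => toPath (α.take k) 0 ++ false :: T)
    (fun T hT => (hmem T).2 hT) (fun T _ T' _ h => by simpa using h) fun P hP => ?_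
  have hP' := hP
  rw [← Finset.mem_coe, coe_dyckPathsCompRR hn hmn hα hk hkl] at hP'
  obtain ⟨g, ⟨-, -, -, h0, hpos, -⟩, rfl⟩ := hP'
  rw [toPath_eq_append hk hkl h0 hpos] at hP ⊢
  exact ⟨_, (hmem _).1 hP, rfl⟩

end

/-- For `m > n`, a composition `α ⊨ n` with `ℓ` parts, `r = rr(α,m)` and
positive integers `k, j` with `k, j ≥ r` and `k + j - r ≤ ℓ`:
`|D_{m,α}^{(k,j)}| = |D_{m,α}^{(k+j-r, r)}| = |T(m, α, k+j-r)|`. -/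
theorem card_comp_run_ret_tPaths (m n : ℕ) (hn : 0 < n) (hmn : n < m)
    (α : List ℕ) (hα : IsComposition n α) (k j : ℕ) (hk : 0 < k) (hj : 0 < j)
    (hkr : rr m α ≤ k) (hjr : rr m α ≤ j) (hlen : k + j - rr m α ≤ α.length) :
    (dyckPathsCompRR m n α k j).card =
        (dyckPathsCompRR m n α (k + j - rr m α) (rr m α)).card ∧
      (dyckPathsCompRR m n α (k + j - rr m α) (rr m α)).card =
        (tPaths m α (k + j - rr m α)).card := by
  rw [← card_dyckPathsCompRR_eq_card_tPaths hn hmn hα (by omega) (by omega) hlen]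
  obtain ⟨d, rfl⟩ := Nat.exists_eq_add_of_le hjr
  rw [show k + (rr m α + d) - rr m α = k + d by omega] at *
  exact ⟨card_dyckPathsCompRR_add hn hmn hα hk hkr hlen, rfl⟩

end RationalDyck
end

section
/- Let m > n be positive integers. Then ∑_{P ∈ D_{m,n}} p^{r̃un(P)} q^{ret(P)} = ∑_{P ∈ D_{m,n}} p^{ret(P)} q^{r̃un(P)} as polynomials in the indeterminates p and q. -/
open scoped Classical

namespace RationalDyck

/-- The generating function by `ret` of the completions of length `l` of a path that has
reached the point `(x, j)`: contacts are weighted by `q`. -/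
def retGF {R : Type*} [CommRing R] (m n : ℕ) (q : R) : ℕ → ℕ → ℕ → R
  | 0, x, j => if x = m ∧ j = n then 1 else 0
  | l + 1, x, j =>
    if (x + 1) * n ≤ j * m then retGF m n q l x (j + 1) + retGF m n q l (x + 1) j
    else q * retGF m n q l x (j + 1)

/-- The sum over `i ≥ 1` of `p ^ (i - 1) * retGF m n q (l - i) x (j + i)`. -/
def shiftGF {R : Type*} [CommRing R] (m n : ℕ) (p q : R) : ℕ → ℕ → ℕ → R
  | 0, _, _ => 0
  | l + 1, x, j => retGF m n q l x (j + 1) + p * shiftGF m n p q l x (j + 1)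

/-- The joint generating function of the completions of length `l` of a path that has reached
the point `(x, j)`: contacts are weighted by `q`, and the consecutive multiples
`s * k, (s + 1) * k, …` occurring as columns of north steps are weighted by `p`. -/
def runRetGF {R : Type*} [CommRing R] (m n k : ℕ) (p q : R) : ℕ → ℕ → ℕ → ℕ → R
  | 0, _, x, j => if x = m ∧ j = n then 1 else 0
  | l + 1, s, x, j =>
    (if (x + 1) * n ≤ j * m then 1 else q) *
        (if x = s * k then p * runRetGF m n k p q l (s + 1) x (j + 1)
          else runRetGF m n k p q l s x (j + 1)) +
      if (x + 1) * n ≤ j * m then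
        (if x = s * k then retGF m n q l (x + 1) j else runRetGF m n k p q l s (x + 1) j)
      else 0

section GeneratingFunctions

variable {R : Type*} [CommRing R] {m n : ℕ}

lemma retGF_zero_succ_eq_zero (hn : 0 < n) {x j : ℕ} (h : (x + 1) * n ≤ j * m) (q : R) :
    retGF m n q 0 x (j + 1) = 0 := by
  rw [retGF, if_neg]
  rintro ⟨rfl, rfl⟩
  nlinarith

lemma retGF_succ (hn : 0 < n) (q : R) (l x j : ℕ) :
    retGF m n q (l + 1) x j =
      (if (x + 1) * n ≤ j * m then retGF m n 1 l (x + 1) j else 0) +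
        q * retGF m n q l x (j + 1) := by
  induction l generalizing x j with
  | zero =>
    by_cases h : (x + 1) * n ≤ j * m
    · rw [retGF.eq_2, if_pos h, if_pos h, retGF_zero_succ_eq_zero hn h]
      simp [retGF]
    · rw [retGF.eq_2, if_neg h, if_neg h, zero_add]
  | succ l ih =>
    by_cases h : (x + 1) * n ≤ j * m
    · have h' : (x + 1) * n ≤ (j + 1) * m := h.trans (Nat.mul_le_mul_right _ (by omega))
      have h1 : retGF m n (1 : R) (l + 1) (x + 1) j = retGF m n 1 l (x + 1) (j + 1) +
          if (x + 1 + 1) * n ≤ j * m then retGF m n 1 l (x + 1 + 1) j else 0 := by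
        rw [retGF]
        split_ifs <;> ring
      have h2 : retGF m n q (l + 1) x (j + 1) =
          retGF m n q l x (j + 1 + 1) + retGF m n q l (x + 1) (j + 1) := by
        rw [retGF, if_pos h']
      have h3 := ih x (j + 1)
      rw [if_pos h'] at h3
      rw [retGF, if_pos h, if_pos h, h1]
      linear_combination h3 + ih (x + 1) j - q * h2
    · rw [retGF, if_neg h, if_neg h, zero_add]

lemma shiftGF_succ (hn : 0 < n) (p q : R) {l x j : ℕ} (h : (x + 1) * n ≤ j * m) :
    shiftGF m n p q (l + 1) x j = shiftGF m n p q l x (j + 1) + shiftGF m n p q l (x + 1) j := by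
  induction l generalizing j with
  | zero => simp [shiftGF, retGF_zero_succ_eq_zero hn h]
  | succ l ih =>
    have h' : (x + 1) * n ≤ (j + 1) * m := h.trans (Nat.mul_le_mul_right _ (by omega))
    have h1 : retGF m n q (l + 1) x (j + 1) =
        retGF m n q l x (j + 1 + 1) + retGF m n q l (x + 1) (j + 1) := by
      rw [retGF, if_pos h']
    have h2 : shiftGF m n p q (l + 1) x (j + 1) =
        retGF m n q l x (j + 1 + 1) + p * shiftGF m n p q l x (j + 1 + 1) := rfl
    have h3 : shiftGF m n p q (l + 1) (x + 1) j =
        retGF m n q l (x + 1) (j + 1) + p * shiftGF m n p q l (x + 1) (j + 1) := rfl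
    rw [shiftGF, h3]
    linear_combination h1 + p * ih h' - h2

lemma shiftGF_symm (hn : 0 < n) (p q : R) (l x j : ℕ) :
    shiftGF m n p q l x j = shiftGF m n q p l x j ∧
      retGF m n q l x j + p * shiftGF m n p q l x j =
        retGF m n p l x j + q * shiftGF m n q p l x j := by
  induction l generalizing x j with
  | zero => simp [shiftGF, retGF]
  | succ l ih =>
    obtain ⟨h1, h2⟩ := ih x (j + 1)
    refine ⟨by simpa only [shiftGF] using h2, ?_⟩
    rw [retGF_succ hn, retGF_succ hn p, shiftGF, shiftGF, ← h1]
    rw [← h1] at h2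
    linear_combination (p + q) * h2

lemma runRetGF_eq (hn : 0 < n) {k : ℕ} (hk : k * n ≤ m) (p q : R) {l s x j : ℕ}
    (hx : x ≤ s * k) (hj : (s * k + 1) * n ≤ j * m) :
    runRetGF m n k p q l s x j = retGF m n q l x j + (p - 1) * shiftGF m n p q l x j := by
  induction l generalizing s x j with
  | zero => simp [runRetGF, retGF, shiftGF]
  | succ l ih =>
    have h : (x + 1) * n ≤ j * m := le_trans (Nat.mul_le_mul_right _ (by omega)) hj
    have hj' : (s * k + 1) * n ≤ (j + 1) * m := hj.trans (Nat.mul_le_mul_right _ (by omega))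
    rw [runRetGF, if_pos h, if_pos h, retGF, if_pos h]
    by_cases hxs : x = s * k
    · rw [if_pos hxs, if_pos hxs, ih (by nlinarith) (by nlinarith), shiftGF]
      ring
    · rw [if_neg hxs, if_neg hxs, ih hx hj', ih (by omega) hj, shiftGF_succ hn p q h]
      ring

lemma runRetGF_symm_of_le (hn : 0 < n) {k : ℕ} (hk : k * n ≤ m) (p q : R) {l s x j : ℕ}
    (hx : x ≤ s * k) (hj : (s * k + 1) * n ≤ j * m) :
    runRetGF m n k p q l s x j = runRetGF m n k q p l s x j := by
  rw [runRetGF_eq hn hk p q hx hj, runRetGF_eq hn hk q p hx hj]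
  obtain ⟨h1, h2⟩ := shiftGF_symm (m := m) hn p q l x j
  linear_combination h2 - h1

lemma runRetGF_symm (hn : 0 < n) (hmn : n < m) {k : ℕ} (hk : k * n ≤ m) (p q : R)
    {l s x : ℕ} (hx : x ≤ s * k) :
    runRetGF m n k p q l s x s = runRetGF m n k q p l s x s := by
  induction l generalizing s x with
  | zero => simp [runRetGF]
  | succ l ih =>
    by_cases hs : (s * k + 1) * n ≤ s * m
    · exact runRetGF_symm_of_le hn hk p q hx hs
    · rw [runRetGF, runRetGF]
      by_cases hxs : x = s * k
      · rw [hxs]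
        simp only [if_neg hs, if_true]
        rw [ih (by nlinarith)]
        ring
      · have h : (x + 1) * n ≤ s * m := by
          have : (x + 1) * n ≤ s * k * n := Nat.mul_le_mul_right _ (by omega)
          nlinarith
        simp only [if_pos h, if_neg hxs]
        rw [ih (show x + 1 ≤ s * k by omega), runRetGF_symm_of_le hn hk p q hx (by nlinarith)]

end GeneratingFunctions

/-- `P` leads from `(x, j)` to `(m, n)` and its east steps end weakly above the diagonal. -/
def IsCompletion (m n : ℕ) : ℕ → ℕ → Path → Prop
  | x, j, [] => x = m ∧ j = n
  | x, j, true :: P => IsCompletion m n x (j + 1) P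
  | x, j, false :: P => (x + 1) * n ≤ j * m ∧ IsCompletion m n (x + 1) j P

/-- The number of contacts of a path `P` starting at `(x, j)`, its endpoint excluded. -/
def retFrom (m n : ℕ) : ℕ → ℕ → Path → ℕ
  | _, _, [] => 0
  | x, j, true :: P => (if (x + 1) * n ≤ j * m then 0 else 1) + retFrom m n x (j + 1) P
  | x, j, false :: P => (if (x + 1) * n ≤ j * m then 0 else 1) + retFrom m n (x + 1) j P

/-- The number of consecutive multiples `s * k, (s + 1) * k, …` which are columns of north steps
of a path `P` starting in column `x`. -/
def hitsFrom (k : ℕ) : ℕ → ℕ → Path → ℕ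
  | _, _, [] => 0
  | s, x, true :: P => if x = s * k then 1 + hitsFrom k (s + 1) x P else hitsFrom k s x P
  | s, x, false :: P => if x = s * k then 0 else hitsFrom k s (x + 1) P

lemma isDyck_iff_isCompletion (m n : ℕ) (P : Path) : IsDyck m n P ↔ IsCompletion m n 0 0 P := by
  suffices h : ∀ x j : ℕ, x * n ≤ j * m → (IsCompletion m n x j P ↔
      x + P.count false = m ∧ j + P.count true = n ∧ ∀ i ≤ P.length,
        (x + (P.take i).count false) * n ≤ (j + (P.take i).count true) * m) by
    rw [h 0 0 (by simp)]
    simp only [IsDyck, prefRank, zero_add, sub_nonneg]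
    norm_cast
  induction P with
  | nil =>
    intro x j h
    simp [IsCompletion, h]
  | cons b P ih =>
    intro x j h
    have hsplit : ∀ p : ℕ → Prop, (∀ i ≤ P.length + 1, p i) ↔ p 0 ∧ ∀ i ≤ P.length, p (i + 1) := by
      intro p
      refine ⟨fun hp => ⟨hp 0 (by omega), fun i hi => hp _ (by omega)⟩, fun hp i hi => ?_⟩
      cases i with
      | zero => exact hp.1
      | succ i => exact hp.2 i (by omega)
    rw [List.length_cons, hsplit]
    cases b with
    | true =>
      rw [IsCompletion, ih x (j + 1) (h.trans (Nat.mul_le_mul_right _ (by omega)))]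
      simp [h, add_comm, add_left_comm]
    | false =>
      rw [IsCompletion]
      constructor
      · rintro ⟨h1, h2⟩
        rw [ih (x + 1) j h1] at h2
        simpa [h, add_assoc, add_comm, add_left_comm] using h2
      · intro h2
        have h1 : (x + 1) * n ≤ j * m := by simpa using h2.2.2.2 0 (by omega)
        refine ⟨h1, (ih (x + 1) j h1).2 ?_⟩
        simpa [h, add_assoc, add_comm, add_left_comm] using h2

lemma retStat_eq_retFrom (m n : ℕ) (P : Path) : retStat m n P = retFrom m n 0 0 P := by
  suffices h : ∀ x j : ℕ, ((List.range P.length).filter fun i =>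
      ¬ (x + (P.take i).count false + 1) * n ≤ (j + (P.take i).count true) * m).length =
        retFrom m n x j P by
    rw [← h 0 0, retStat]
    congr 2
    ext i
    rw [decide_eq_decide, prefRank, zero_add, zero_add, not_le]
    zify
    constructor <;> intro h <;> linarith
  induction P with
  | nil => simp [retFrom]
  | cons b P ih =>
    intro x j
    rw [List.length_cons, List.range_succ_eq_map, List.filter_cons, List.filter_map]
    cases b with
    | true =>
      rw [retFrom, ← ih x (j + 1)]
      by_cases h : (x + 1) * n ≤ j * m <;>
        simp [h, Function.comp_def, add_assoc, add_comm, add_left_comm]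
    | false =>
      rw [retFrom, ← ih (x + 1) j]
      by_cases h : (x + 1) * n ≤ j * m <;>
        simp [h, Function.comp_def, add_assoc, add_comm, add_left_comm]

lemma coarea_true_cons (P : Path) : coarea (true :: P) = 0 :: coarea P := by
  simp [coarea, List.range_succ_eq_map, List.filterMap_map]

lemma coarea_false_cons (P : Path) : coarea (false :: P) = (coarea P).map (· + 1) := by
  simp only [coarea, List.length_cons, List.range_succ_eq_map, List.filterMap_cons,
    List.filterMap_map, List.map_filterMap, Function.comp_def]
  simp

lemma hitsFrom_le_count (k s x : ℕ) (P : Path) : hitsFrom k s x P ≤ P.count true := by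
  induction P generalizing s x with
  | nil => simp [hitsFrom]
  | cons b P ih =>
    cases b with
    | true =>
      have h1 := ih (s + 1) x
      have h2 := ih s x
      rw [hitsFrom, List.count_cons_self]
      split_ifs <;> omega
    | false =>
      have h1 := ih s (x + 1)
      rw [hitsFrom, List.count_cons_of_ne (by simp)]
      split_ifs <;> omega

lemma exists_mem_coarea_of_lt_hitsFrom {k s x i : ℕ} {P : Path} (hi : i < hitsFrom k s x P) :
    ∃ u ∈ coarea P, x + u = (s + i) * k := by
  induction P generalizing s x i with
  | nil => simp [hitsFrom] at hi
  | cons b P ih =>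
    cases b with
    | true =>
      rw [hitsFrom] at hi
      rw [coarea_true_cons]
      split_ifs at hi with hx
      · cases i with
        | zero => exact ⟨0, by simp, by simpa using hx⟩
        | succ i =>
          obtain ⟨u, hu, h⟩ := ih (show i < hitsFrom k (s + 1) x P by omega)
          exact ⟨u, List.mem_cons_of_mem _ hu, by rw [h]; ring⟩
      · obtain ⟨u, hu, h⟩ := ih hi
        exact ⟨u, List.mem_cons_of_mem _ hu, h⟩
    | false =>
      rw [hitsFrom] at hi
      split_ifs at hi with hx
      · omega
      · obtain ⟨u, hu, h⟩ := ih hi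
        rw [coarea_false_cons]
        exact ⟨u + 1, List.mem_map_of_mem hu, by omega⟩

lemma add_ne_of_mem_coarea {k s x u : ℕ} (hk : 0 < k) {P : Path} (hx : x ≤ s * k)
    (hu : u ∈ coarea P) : x + u ≠ (s + hitsFrom k s x P) * k := by
  induction P generalizing s x u with
  | nil => simp [coarea] at hu
  | cons b P ih =>
    cases b with
    | true =>
      rw [coarea_true_cons, List.mem_cons] at hu
      rw [hitsFrom]
      split_ifs with hxs
      · rw [← add_assoc]
        obtain rfl | hu := hu
        · nlinarith
        · exact ih (by nlinarith) hu
      · obtain rfl | hu := hu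
        · have : s * k ≤ (s + hitsFrom k s x P) * k := Nat.mul_le_mul_right _ (by omega)
          omega
        · exact ih hx hu
    | false =>
      rw [coarea_false_cons, List.mem_map] at hu
      obtain ⟨v, hv, rfl⟩ := hu
      rw [hitsFrom]
      split_ifs with hxs
      · rw [add_zero]
        omega
      · have := ih (show x + 1 ≤ s * k by omega) hv
        omega

lemma ratioRun_eq_hitsFrom {m n : ℕ} (hn : 0 < n) (hmn : n < m) {P : Path}
    (hP : IsCompletion m n 0 0 P) : ratioRun m n P = hitsFrom (m / n) 0 0 P := by
  have hk : 0 < m / n := Nat.div_pos hmn.le hn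
  have hpos : 1 ≤ hitsFrom (m / n) 0 0 P := by
    match P, hP with
    | [], hP => exact absurd hP.2 hn.ne
    | true :: P, _ => simp [hitsFrom]
    | false :: P, hP =>
      have := hP.1
      omega
  refine IsLeast.csInf_eq ⟨⟨hpos, hitsFrom_le_count _ _ _ _, fun h => ?_⟩, ?_⟩
  · refine add_ne_of_mem_coarea hk (s := 0) (x := 0) (by simp) h ?_
    ring
  · rintro i ⟨-, -, hi⟩
    by_contra! hlt
    obtain ⟨u, hu, h⟩ := exists_mem_coarea_of_lt_hitsFrom hlt
    refine hi ?_
    convert hu using 1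
    linarith

section Sums

variable {R : Type*} [CommRing R]

lemma sum_ofFn_succ (l : ℕ) (F : Path → R) :
    ∑ g : Fin (l + 1) → Bool, F (List.ofFn g) =
      ∑ g : Fin l → Bool, F (true :: List.ofFn g) +
        ∑ g : Fin l → Bool, F (false :: List.ofFn g) := by
  rw [← (Fin.consEquiv fun _ : Fin (l + 1) => Bool).sum_comp, Fintype.sum_prod_type]
  simp [Fin.consEquiv, List.ofFn_succ]

lemma sum_isCompletion_retFrom (m n : ℕ) (q : R) (l x j : ℕ) :
    ∑ g : Fin l → Bool, (if IsCompletion m n x j (List.ofFn g) then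
      q ^ retFrom m n x j (List.ofFn g) else 0) = retGF m n q l x j := by
  induction l generalizing x j with
  | zero => simp [IsCompletion, retFrom, retGF]
  | succ l ih =>
    rw [sum_ofFn_succ l fun P => if IsCompletion m n x j P then q ^ retFrom m n x j P else 0]
    by_cases h : (x + 1) * n ≤ j * m
    · simp only [IsCompletion, retFrom, retGF, h, if_true, true_and, zero_add, ih]
    · simp only [IsCompletion, retFrom, retGF, h, if_false, false_and, pow_add, pow_one,
        Finset.sum_const_zero, add_zero, ← ih x (j + 1), Finset.mul_sum, mul_ite, mul_zero]

lemma sum_isCompletion_hitsFrom_retFrom (m n k : ℕ) (p q : R) (l s x j : ℕ) :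
    ∑ g : Fin l → Bool, (if IsCompletion m n x j (List.ofFn g) then
      p ^ hitsFrom k s x (List.ofFn g) * q ^ retFrom m n x j (List.ofFn g) else 0) =
        runRetGF m n k p q l s x j := by
  induction l generalizing s x j with
  | zero => simp [IsCompletion, hitsFrom, retFrom, runRetGF]
  | succ l ih =>
    rw [sum_ofFn_succ l fun P => if IsCompletion m n x j P then
      p ^ hitsFrom k s x P * q ^ retFrom m n x j P else 0, runRetGF]
    congr 1
    · simp only [IsCompletion, hitsFrom, retFrom, ← ih]
      split_ifs <;> simp only [Finset.mul_sum] <;> refine Finset.sum_congr rfl fun g _ => ?_ <;>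
        split_ifs <;> ring
    · by_cases h : (x + 1) * n ≤ j * m
      · by_cases hx : x = s * k
        · simp only [IsCompletion, hitsFrom, retFrom, hx ▸ h, hx, if_true, true_and, zero_add,
            pow_zero, one_mul, sum_isCompletion_retFrom]
        · simp only [IsCompletion, hitsFrom, retFrom, h, hx, if_true, if_false, true_and,
            zero_add, ih]
      · simp [IsCompletion, h]

lemma sum_dyckPaths_eq_runRetGF {m n : ℕ} (hn : 0 < n) (hmn : n < m) (p q : R) :
    ∑ P ∈ dyckPaths m n, p ^ ratioRun m n P * q ^ retStat m n P =
      runRetGF m n (m / n) p q (m + n) 0 0 0 := by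
  rw [← sum_isCompletion_hitsFrom_retFrom, dyckPaths, Finset.sum_filter,
    Finset.sum_image fun _ _ _ _ h => List.ofFn_injective h]
  refine Finset.sum_congr rfl fun g _ => ?_
  rw [isDyck_iff_isCompletion]
  split_ifs with h
  · rw [ratioRun_eq_hitsFrom hn hmn h, retStat_eq_retFrom]
  · rfl

end Sums

open MvPolynomial in
/-- For `m > n`, the joint distribution of `(r̃un, ret)` on `D_{m,n}` is
symmetric, as an identity of polynomials in `p = X 0` and `q = X 1`. -/
theorem ratioRun_ret_symmetric (m n : ℕ) (hn : 0 < n) (hmn : n < m) :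
    (∑ P ∈ dyckPaths m n,
        (X 0 : MvPolynomial (Fin 2) ℚ) ^ ratioRun m n P * (X 1) ^ retStat m n P) =
      ∑ P ∈ dyckPaths m n,
        (X 0 : MvPolynomial (Fin 2) ℚ) ^ retStat m n P * (X 1) ^ ratioRun m n P := by
  rw [sum_dyckPaths_eq_runRetGF hn hmn,
    runRetGF_symm hn hmn (Nat.div_mul_le_self m n) _ _ (by simp),
    ← sum_dyckPaths_eq_runRetGF hn hmn]
  exact Finset.sum_congr rfl fun P _ => mul_comm _ _

end RationalDyck
end
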